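/- The set of quadruples of integers (k₂, k₃, a, b) satisfying all of: k₂ ≥ 2, k₃ ≥ 3, k₂ + k₃ ≤ 12, 2a + 3b = 0, k₂·a + k₃·b = −6, and a > b, is exactly the five-element set {(2, 4, 9, −6), (2, 6, 3, −2), (3, 5, 18, −12), (3, 6, 6, −4), (4, 7, 9, −6)}. -/

import Mathlib

/-- Classification of the possible values of `(k₂, k₃, L₂·f', L₃·f')`
(Table 1 of the paper). -/
theorem standard_model_bundles_table :
    {p : ℤ × ℤ × ℤ × ℤ |
      2 ≤ p.1 ∧ 3 ≤ p.2.1 ∧ p.1 + p.2.1 ≤ 12 ∧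
      2 * p.2.2.1 + 3 * p.2.2.2 = 0 ∧
      p.1 * p.2.2.1 + p.2.1 * p.2.2.2 = -6 ∧
      p.2.2.2 < p.2.2.1} =
    {(2, 4, 9, -6), (2, 6, 3, -2), (3, 5, 18, -12), (3, 6, 6, -4), (4, 7, 9, -6)} := by
  ext ⟨k₂, k₃, a, b⟩
  simp only [Set.mem_ofPred_eq, Set.mem_insert_iff, Set.mem_singleton_iff, Prod.mk.injEq]
  constructor
  · rintro ⟨hk₂, hk₃, hk, hc₁, hgen, hab⟩
    have hk₂' : k₂ ≤ 9 := by omega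
    have hk₃' : k₃ ≤ 10 := by omega
    interval_cases k₂ <;> interval_cases k₃ <;> omega
  · rintro (⟨rfl, rfl, rfl, rfl⟩ | ⟨rfl, rfl, rfl, rfl⟩ | ⟨rfl, rfl, rfl, rfl⟩ |
      ⟨rfl, rfl, rfl, rfl⟩ | ⟨rfl, rfl, rfl, rfl⟩) <;> norm_num
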